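/- There exist a closed densely defined operator T and an unbounded normal operator M on a Hilbert space such that TM ⊆ MT but TM* ⊄ M*T and M*T ⊄ TM*. Hence the Fuglede theorem fails for closed T without the domain assumption dom(M) ⊆ dom(T). -/

import Mathlib

open LinearPMap

/-- Composition of partial linear maps: `T.pcomp S` is "first `S`, then `T`", with
domain `{x ∈ dom S : S x ∈ dom T}`. -/
noncomputable def LinearPMap.pcomp {H : Type*} [NormedAddCommGroup H] [InnerProductSpace ℂ H]
    (T S : H →ₗ.[ℂ] H) : H →ₗ.[ℂ] H where
  domain := (Submodule.comap S.toFun T.domain).map S.domain.subtype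
  toFun := T.toFun ∘ₗ (S.toFun.restrict fun _ hx => hx) ∘ₗ
    (Submodule.equivMapOfInjective S.domain.subtype S.domain.injective_subtype
      (Submodule.comap S.toFun T.domain)).symm.toLinearMap

/-- A densely defined closed operator `N` on a complex Hilbert space is normal if
`N* N = N N*` (as partial linear maps). -/
noncomputable def LinearPMap.IsNormalOp {H : Type*} [NormedAddCommGroup H]
    [InnerProductSpace ℂ H] [CompleteSpace H] (N : H →ₗ.[ℂ] H) : Prop :=
  Dense (N.domain : Set H) ∧ N.IsClosed ∧ N.adjoint.pcomp N = N.pcomp N.adjoint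

/-- A bounded everywhere-defined operator viewed as a partial linear map. -/
noncomputable def ContinuousLinearMap.toPMapTop {H : Type*} [NormedAddCommGroup H]
    [InnerProductSpace ℂ H] (A : H →L[ℂ] H) : H →ₗ.[ℂ] H :=
  (A : H →ₗ[ℂ] H).toPMap ⊤

/-- The block diagonal operator `diag(N, M)` on `H ⊕ H` with domain `dom N ⊕ dom M`,
acting by `(x, y) ↦ (N x, M y)`. -/
noncomputable def pdiag {H : Type*} [NormedAddCommGroup H] [InnerProductSpace ℂ H]
    (N M : H →ₗ.[ℂ] H) : WithLp 2 (H × H) →ₗ.[ℂ] WithLp 2 (H × H) where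
  domain := (N.domain.prod M.domain).comap (WithLp.linearEquiv 2 ℂ (H × H)).toLinearMap
  toFun := (WithLp.linearEquiv 2 ℂ (H × H)).symm.toLinearMap ∘ₗ
    ((N.toFun ∘ₗ (LinearMap.restrict (LinearMap.fst ℂ H H ∘ₗ (WithLp.linearEquiv 2 ℂ (H × H)).toLinearMap)
        (p := (N.domain.prod M.domain).comap (WithLp.linearEquiv 2 ℂ (H × H)).toLinearMap)
        (q := N.domain) fun _ hx => hx.1)).prod
      (M.toFun ∘ₗ (LinearMap.restrict (LinearMap.snd ℂ H H ∘ₗ (WithLp.linearEquiv 2 ℂ (H × H)).toLinearMap)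
        (p := (N.domain.prod M.domain).comap (WithLp.linearEquiv 2 ℂ (H × H)).toLinearMap)
        (q := M.domain) fun _ hx => hx.2)))

/-- The block operator `(x, y) ↦ (0, T x)` on `H ⊕ H` (the operator matrix with `T` in the
lower-left corner and zeros elsewhere), with domain `dom T ⊕ H`. -/
noncomputable def pblockLL {H : Type*} [NormedAddCommGroup H] [InnerProductSpace ℂ H]
    (T : H →ₗ.[ℂ] H) : WithLp 2 (H × H) →ₗ.[ℂ] WithLp 2 (H × H) where
  domain := (T.domain.prod ⊤).comap (WithLp.linearEquiv 2 ℂ (H × H)).toLinearMap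
  toFun := (WithLp.linearEquiv 2 ℂ (H × H)).symm.toLinearMap ∘ₗ
    ((0 : _ →ₗ[ℂ] H).prod
      (T.toFun ∘ₗ (LinearMap.restrict (LinearMap.fst ℂ H H ∘ₗ (WithLp.linearEquiv 2 ℂ (H × H)).toLinearMap)
        (p := (T.domain.prod ⊤).comap (WithLp.linearEquiv 2 ℂ (H × H)).toLinearMap)
        (q := T.domain) fun _ hx => hx.1)))

/-- The block operator `(x, y) ↦ (S y, 0)` on `H ⊕ H` (the operator matrix with `S` in the
upper-right corner and zeros elsewhere), with domain `H ⊕ dom S`. -/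
noncomputable def pblockUR {H : Type*} [NormedAddCommGroup H] [InnerProductSpace ℂ H]
    (S : H →ₗ.[ℂ] H) : WithLp 2 (H × H) →ₗ.[ℂ] WithLp 2 (H × H) where
  domain := ((⊤ : Submodule ℂ H).prod S.domain).comap (WithLp.linearEquiv 2 ℂ (H × H)).toLinearMap
  toFun := (WithLp.linearEquiv 2 ℂ (H × H)).symm.toLinearMap ∘ₗ
    ((S.toFun ∘ₗ (LinearMap.restrict (LinearMap.snd ℂ H H ∘ₗ (WithLp.linearEquiv 2 ℂ (H × H)).toLinearMap)
        (p := ((⊤ : Submodule ℂ H).prod S.domain).comap (WithLp.linearEquiv 2 ℂ (H × H)).toLinearMap)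
        (q := S.domain) fun _ hx => hx.2)).prod 0)

open MeasureTheory

/-- The Hilbert space `L²(ℝ) ⊕ L²(ℝ)`. -/
noncomputable abbrev L2PlusL2 : Type :=
  WithLp 2 ((Lp ℂ 2 (volume : Measure ℝ)) × (Lp ℂ 2 (volume : Measure ℝ)))

section FugledeAux

open scoped InnerProductSpace

theorem fug_mem_graph_pcomp {H : Type*} [NormedAddCommGroup H] [InnerProductSpace ℂ H]
    (T S : H →ₗ.[ℂ] H) (x z : H) :
    (x, z) ∈ (T.pcomp S).graph ↔ ∃ y, (x, y) ∈ S.graph ∧ (y, z) ∈ T.graph := by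
  have key : ∀ (a : S.domain) (h : S.toFun a ∈ T.domain)
      (h' : (a : H) ∈ (T.pcomp S).domain), (T.pcomp S) ⟨a, h'⟩ = T ⟨S.toFun a, h⟩ := by
    intro a h h'
    have : (Submodule.equivMapOfInjective S.domain.subtype S.domain.injective_subtype
      (Submodule.comap S.toFun T.domain)).symm ⟨a, h'⟩ = ⟨a, h⟩ := by
      rw [LinearEquiv.symm_apply_eq]
      rfl
    change T.toFun ((S.toFun.restrict (p := Submodule.comap S.toFun T.domain)
      (q := T.domain) fun _ hx => hx)
      ((Submodule.equivMapOfInjective S.domain.subtype S.domain.injective_subtype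
      (Submodule.comap S.toFun T.domain)).symm ⟨a, h'⟩)) = _
    rw [this]
    rfl
  constructor
  · intro h
    rw [LinearPMap.mem_graph_iff] at h
    obtain ⟨⟨w, hw⟩, h1, h2⟩ := h
    obtain ⟨a, ha, rfl⟩ := hw
    simp only at h1 h2
    refine ⟨S a, ?_, ?_⟩
    · rw [LinearPMap.mem_graph_iff]
      exact ⟨a, h1, rfl⟩
    · rw [LinearPMap.mem_graph_iff]
      refine ⟨⟨S.toFun a, ha⟩, rfl, ?_⟩
      rw [← h2]
      exact (key a ha _).symm
  · rintro ⟨y, h1, h2⟩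
    rw [LinearPMap.mem_graph_iff] at h1 h2
    obtain ⟨a, rfl, rfl⟩ := h1
    obtain ⟨⟨b, hb⟩, h3, rfl⟩ := h2
    simp only at h3
    subst h3
    rw [LinearPMap.mem_graph_iff]
    have h' : (a : H) ∈ (T.pcomp S).domain := ⟨a, hb, rfl⟩
    exact ⟨⟨a, h'⟩, rfl, key a hb h'⟩

theorem fug_graph_top {H : Type*} [NormedAddCommGroup H] [InnerProductSpace ℂ H]
    (A : H →L[ℂ] H) (G : Submodule ℂ H) (x y : H) :
    (x, y) ∈ ((A : H →ₗ[ℂ] H).toPMap G).graph ↔ x ∈ G ∧ A x = y := by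
  rw [LinearPMap.mem_graph_iff]
  constructor
  · rintro ⟨⟨a, ha⟩, rfl, rfl⟩
    exact ⟨ha, rfl⟩
  · rintro ⟨h, rfl⟩
    exact ⟨⟨x, h⟩, rfl, rfl⟩

theorem fug_closed {H : Type*} [NormedAddCommGroup H] [InnerProductSpace ℂ H]
    (A : H →L[ℂ] H) (G : Submodule ℂ H) (hG : IsClosed (G : Set H)) :
    ((A : H →ₗ[ℂ] H).toPMap G).IsClosed := by
  have : (((A : H →ₗ[ℂ] H).toPMap G).graph : Set (H × H)) =
      {p | p.1 ∈ G} ∩ {p | A p.1 = p.2} := by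
    ext ⟨x, y⟩
    exact fug_graph_top A G x y
  unfold LinearPMap.IsClosed
  rw [this]
  exact (hG.preimage continuous_fst).inter
    (isClosed_eq (A.continuous.comp continuous_fst) continuous_snd)

theorem fug_abstract {H : Type*} [NormedAddCommGroup H] [InnerProductSpace ℂ H]
    [CompleteSpace H] (B M Ms : H →L[ℂ] H) (G : Submodule ℂ H)
    (hB : Function.Injective B) (hG : IsClosed (G : Set H))
    (hd : Dense (B '' (G : Set H)))
    (hadj : ∀ x y, ⟪Ms x, y⟫_ℂ = ⟪x, M y⟫_ℂ)
    (hn : ∀ x, Ms (M x) = M (Ms x))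
    (h1 : ∀ x, ∀ z ∈ G, M x = B z → ∃ z' ∈ G, B z' = x ∧ M z' = z)
    (h2 : ∃ x, ∃ z ∈ G, Ms x = B z ∧ ∀ z' ∈ G, B z' ≠ x)
    (h3 : ∃ z ∈ G, ∀ z' ∈ G, Ms (B z) ≠ B z') :
    ∃ T M : H →ₗ.[ℂ] H,
      T.IsClosed ∧ Dense (T.domain : Set H) ∧ M.IsNormalOp ∧
        T.pcomp M ≤ M.pcomp T ∧
        ¬(T.pcomp M.adjoint ≤ M.adjoint.pcomp T) ∧
        ¬(M.adjoint.pcomp T ≤ T.pcomp M.adjoint) := by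
  have hMs : Ms = ContinuousLinearMap.adjoint M := by
    rw [ContinuousLinearMap.eq_adjoint_iff]
    exact hadj
  have hadjP : ((M : H →ₗ[ℂ] H).toPMap ⊤).adjoint = (Ms : H →ₗ[ℂ] H).toPMap ⊤ := by
    rw [hMs]
    exact ContinuousLinearMap.toPMap_adjoint_eq_adjoint_toPMap_of_dense M (by simp)
  have hker : LinearMap.ker ((B : H →ₗ[ℂ] H).toPMap G).toFun = ⊥ := by
    rw [LinearMap.ker_eq_bot]
    intro a b hab
    exact Subtype.ext (hB hab)
  have hT : ∀ x z, (x, z) ∈ ((B : H →ₗ[ℂ] H).toPMap G).inverse.graph ↔ z ∈ G ∧ B z = x := by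
    intro x z
    rw [LinearPMap.inverse_graph hker, ← fug_graph_top]
    simp
  refine ⟨((B : H →ₗ[ℂ] H).toPMap G).inverse, (M : H →ₗ[ℂ] H).toPMap ⊤, ?_, ?_, ?_, ?_, ?_, ?_⟩
  · rw [LinearPMap.inverse_closed_iff hker]
    exact fug_closed B G hG
  · rw [LinearPMap.inverse_domain]
    convert hd using 1
    ext x
    constructor
    · rintro ⟨⟨a, ha⟩, rfl⟩
      exact ⟨a, ha, rfl⟩
    · rintro ⟨a, ha, rfl⟩
      exact ⟨⟨a, ha⟩, rfl⟩
  · refine ⟨by simp, fug_closed M ⊤ (by simp), ?_⟩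
    apply LinearPMap.eq_of_eq_graph
    ext ⟨x, z⟩
    rw [hadjP, fug_mem_graph_pcomp, fug_mem_graph_pcomp]
    simp only [fug_graph_top]
    simp [hn]
  · apply LinearPMap.le_of_le_graph
    rintro ⟨x, z⟩ h
    rw [fug_mem_graph_pcomp] at h ⊢
    simp only [fug_graph_top, hT] at h ⊢
    obtain ⟨y, ⟨-, rfl⟩, hz, hy⟩ := h
    obtain ⟨z', h4, h5, h6⟩ := h1 x z hz hy.symm
    exact ⟨z', ⟨h4, h5⟩, trivial, h6⟩
  · intro hle
    obtain ⟨x, z, hz, h4, h5⟩ := h2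
    have := LinearPMap.le_graph_of_le hle (x := (x, z))
    rw [hadjP, fug_mem_graph_pcomp, fug_mem_graph_pcomp] at this
    simp only [fug_graph_top, hT] at this
    obtain ⟨y, ⟨h6, h7⟩, -⟩ := this ⟨Ms x, ⟨trivial, rfl⟩, hz, h4.symm⟩
    exact h5 y h6 h7
  · intro hle
    obtain ⟨z, hz, h4⟩ := h3
    have := LinearPMap.le_graph_of_le hle (x := (B z, Ms z))
    rw [hadjP, fug_mem_graph_pcomp, fug_mem_graph_pcomp] at this
    simp only [fug_graph_top, hT] at this
    obtain ⟨y, ⟨-, h6⟩, h7, h8⟩ := this ⟨z, ⟨hz, rfl⟩, trivial, rfl⟩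
    exact h4 _ h7 (by rw [h6, h8])

end FugledeAux
section FugledeDim

theorem fug_equiv (E : Type) [NormedAddCommGroup E] [InnerProductSpace ℂ E] [CompleteSpace E]
    [TopologicalSpace.SeparableSpace E] (hE : ¬ FiniteDimensional ℂ E) :
    Nonempty (E ≃ₗᵢ[ℂ] lp (fun _ : ℤ × ℕ => ℂ) 2) := by
  obtain ⟨w, b, hb⟩ := exists_hilbertBasis ℂ E
  have hc : Countable w := by
    apply Pairwise.countable_of_isOpen_disjoint (s := fun i : w => Metric.ball (b i) (1/2 : ℝ))
    · intro i j hij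
      apply Metric.ball_disjoint_ball
      have h2 : ‖b i - b j‖ * ‖b i - b j‖ = 2 := by
        have h0 := b.orthonormal.2 hij
        have := @norm_sub_mul_self ℂ E _ _ _ (b i) (b j)
        rw [this, h0, b.orthonormal.1, b.orthonormal.1]
        simp; norm_num
      rw [dist_eq_norm]
      nlinarith [norm_nonneg (b i - b j)]
    · intro i; exact Metric.isOpen_ball
    · intro i; exact ⟨b i, by simp⟩
  have hi : Infinite w := by
    by_contra hcon
    rw [not_infinite_iff_finite] at hcon
    have := Fintype.ofFinite w
    exact hE b.toOrthonormalBasis.toBasis.finiteDimensional_of_finite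
  have e : w ≃ ℤ × ℕ := Classical.choice (by
    have := nonempty_denumerable_iff.2 ⟨hc, hi⟩
    exact nonempty_equiv_of_countable)
  have hb' : Orthonormal ℂ (b ∘ e.symm) := b.orthonormal.comp _ e.symm.injective
  have b' := HilbertBasis.mk hb' (by
    rw [Function.Surjective.range_comp e.symm.surjective, b.dense_span])
  exact ⟨b'.repr⟩

theorem fug_infdim : ¬ FiniteDimensional ℂ L2PlusL2 := by
  intro h
  have h1 : FiniteDimensional ℂ (Lp ℂ 2 (volume : Measure ℝ)) := by
    refine FiniteDimensional.of_surjective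
      (LinearMap.fst ℂ _ _ ∘ₗ (WithLp.linearEquiv 2 ℂ ((Lp ℂ 2 (volume : Measure ℝ)) × (Lp ℂ 2 (volume : Measure ℝ)))).toLinearMap) ?_
    intro x
    exact ⟨WithLp.toLp 2 (x, 0), rfl⟩
  have hf : ∀ n : ℕ, volume (Set.Ico (n : ℝ) (n + 1)) ≠ ⊤ := by intro n; simp
  let v : ℕ → Lp ℂ 2 (volume : Measure ℝ) := fun n =>
    indicatorConstLp 2 (measurableSet_Ico (a := (n : ℝ)) (b := n + 1)) (hf n) (1 : ℂ)
  have hin : ∀ m n, inner ℂ (v m) (v n) =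
      if m = n then (1 : ℂ) else 0 := by
    intro m n
    simp only [v]
    rw [L2.inner_indicatorConstLp_indicatorConstLp (hμs := hf m) (hμt := hf n)]
    split_ifs with hmn
    · subst hmn; simp
    · have : Set.Ico (m : ℝ) (m + 1) ∩ Set.Ico (n : ℝ) (n + 1) = ∅ := by
        ext x
        simp only [Set.mem_inter_iff, Set.mem_Ico, Set.mem_empty_iff_false, iff_false]
        rintro ⟨⟨a, b⟩, c, d⟩
        have e1 : (m : ℝ) < n + 1 := by linarith
        have e2 : (n : ℝ) < m + 1 := by linarith
        norm_cast at e1 e2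
        omega
      rw [this]; simp
  have ho : Orthonormal ℂ v := by
    rw [orthonormal_iff_ite]; exact hin
  have := ho.linearIndependent.finite
  exact not_finite ℕ

instance fug_sep : TopologicalSpace.SeparableSpace L2PlusL2 := by
  have : Fact ((2 : ENNReal) ≠ ⊤) := ⟨by simp⟩
  have : SecondCountableTopology (Lp ℂ 2 (volume : Measure ℝ)) := inferInstance
  infer_instance
end FugledeDim
section FugledeConcrete

open scoped InnerProductSpace

abbrev FugL : Type := lp (fun _ : ℤ × ℕ => ℂ) 2

def fugShift (s : ℤ) : ℤ × ℕ ≃ ℤ × ℕ := (Equiv.addRight s).prodCongr (Equiv.refl ℕ)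

theorem fug_summable_sq (f : FugL) : Summable fun p => ‖f p‖ ^ 2 := by
  have := (lp.memℓp f).summable (by simp)
  simpa using this

theorem fug_memlp_iff (f : ℤ × ℕ → ℂ) : Memℓp f 2 ↔ Summable fun p => ‖f p‖ ^ 2 := by
  rw [memℓp_gen_iff (by simp)]
  simp

theorem fug_norm_sq (f : FugL) : ‖f‖ ^ 2 = ∑' p, ‖f p‖ ^ 2 := by
  have := lp.norm_rpow_eq_tsum (p := 2) (by simp) f
  simpa using this

theorem fug_op_exists (s : ℤ) (a : ℕ → ℝ) (C : ℝ) (ha : ∀ j, |a j| ≤ C) :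
    ∃ W : FugL →L[ℂ] FugL, ∀ f p, W f p = (a p.2 : ℂ) * f (p.1 + s, p.2) := by
  have hC : 0 ≤ C := (abs_nonneg _).trans (ha 0)
  have hs : ∀ f : FugL, Summable fun p : ℤ × ℕ => C ^ 2 * ‖f (p.1 + s, p.2)‖ ^ 2 := by
    intro f
    exact (((fugShift s).summable_iff (f := fun p => ‖f p‖ ^ 2)).2 (fug_summable_sq f)).mul_left _
  have hle : ∀ (f : FugL) (p : ℤ × ℕ), ‖(a p.2 : ℂ) * f (p.1 + s, p.2)‖ ^ 2 ≤
      C ^ 2 * ‖f (p.1 + s, p.2)‖ ^ 2 := by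
    intro f p
    rw [norm_mul, mul_pow, Complex.norm_real, Real.norm_eq_abs]
    have := ha p.2
    gcongr
  have hm : ∀ f : FugL, Memℓp (fun p : ℤ × ℕ => (a p.2 : ℂ) * f (p.1 + s, p.2)) 2 := by
    intro f
    rw [fug_memlp_iff]
    exact Summable.of_nonneg_of_le (fun _ => by positivity) (hle f) (hs f)
  let L : FugL →ₗ[ℂ] FugL :=
    { toFun := fun f => ⟨fun p => (a p.2 : ℂ) * f (p.1 + s, p.2), hm f⟩
      map_add' := by
        intro f g
        ext p
        exact mul_add _ _ _
      map_smul' := by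
        intro c f
        ext p
        simp; ring }
  refine ⟨L.mkContinuous C ?_, fun f p => rfl⟩
  intro f
  have h1 : ‖L f‖ ^ 2 ≤ (C * ‖f‖) ^ 2 := by
    rw [fug_norm_sq, mul_pow, fug_norm_sq, ← (fugShift s).tsum_eq (fun p => ‖f p‖ ^ 2),
      ← tsum_mul_left]
    exact Summable.tsum_le_tsum (hle f) ((fug_memlp_iff _).1 (hm f)) (hs f)
  exact (pow_le_pow_iff_left₀ (norm_nonneg _) (by positivity) two_ne_zero).1 h1

noncomputable def fugOp (s : ℤ) (a : ℕ → ℝ) (C : ℝ) (ha : ∀ j, |a j| ≤ C) : FugL →L[ℂ] FugL :=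
  (fug_op_exists s a C ha).choose

theorem fugOp_apply (s : ℤ) (a : ℕ → ℝ) (C : ℝ) (ha : ∀ j, |a j| ≤ C) (f : FugL) (p : ℤ × ℕ) :
    fugOp s a C ha f p = (a p.2 : ℂ) * f (p.1 + s, p.2) :=
  (fug_op_exists s a C ha).choose_spec f p

theorem fugOp_inner (s : ℤ) (a : ℕ → ℝ) (C : ℝ) (ha : ∀ j, |a j| ≤ C) (f g : FugL) :
    ⟪fugOp s a C ha f, g⟫_ℂ = ⟪f, fugOp (-s) a C ha g⟫_ℂ := by
  rw [lp.inner_eq_tsum, lp.inner_eq_tsum,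
    ← (fugShift s).tsum_eq (fun p => ⟪f p, fugOp (-s) a C ha g p⟫_ℂ)]
  congr 1
  ext p
  have hp : fugShift s p = (p.1 + s, p.2) := rfl
  simp only [fugOp_apply, RCLike.inner_apply, hp]
  simp
  ring

noncomputable def fugR (j : ℕ) : ℝ := if j = 0 then 2 else 1
noncomputable def fugC (j : ℕ) : ℝ := 1 / ((j : ℝ) + 1)

theorem fugR_pos (j : ℕ) : 0 < fugR j := by unfold fugR; split_ifs <;> norm_num
theorem fugC_pos (j : ℕ) : 0 < fugC j := by unfold fugC; positivity
theorem fugR_le (j : ℕ) : |fugR j| ≤ 2 := by unfold fugR; split_ifs <;> norm_num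
theorem fugRi_le (j : ℕ) : |(fugR j)⁻¹| ≤ 1 := by unfold fugR; split_ifs <;> norm_num
theorem fugC_le (j : ℕ) : |fugC j| ≤ 1 := by
  rw [abs_of_pos (fugC_pos j)]
  unfold fugC
  rw [div_le_one (by positivity)]
  linarith [(Nat.cast_nonneg j : (0 : ℝ) ≤ j)]

theorem fugC_sum : Summable fun j => fugC j ^ 2 := by
  have := (summable_nat_add_iff 1).2 (Real.summable_one_div_nat_pow (p := 2).2 (by norm_num))
  simpa [fugC] using this

theorem fugV_mem (k : ℤ) : Memℓp (fun p : ℤ × ℕ =>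
    if p.1 = k then ((fugC p.2 * fugR p.2 ^ (-k) : ℝ) : ℂ) else 0) 2 := by
  rw [fug_memlp_iff]
  have hinj : Function.Injective (fun j : ℕ => (k, j)) := fun a b h => by simpa using h
  rw [← hinj.summable_iff]
  · refine Summable.of_nonneg_of_le (fun _ => sq_nonneg _) ?_
      (fugC_sum.mul_left ((1 + 2 ^ (-k)) ^ 2))
    intro j
    simp only [Function.comp, if_true, Complex.norm_real, Real.norm_eq_abs, sq_abs]
    rw [mul_pow, mul_comm]
    have h1 : 0 ≤ fugR j ^ (-k) := by have := fugR_pos j; positivity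
    have h2 : fugR j ^ (-k) ≤ 1 + 2 ^ (-k) := by
      have : (0 : ℝ) ≤ 2 ^ (-k) := by positivity
      unfold fugR; split_ifs
      · linarith
      · simp only [one_zpow]; linarith
    gcongr
  · intro p hp
    have : p.1 ≠ k := by
      rintro rfl
      exact hp ⟨p.2, rfl⟩
    simp [this]

noncomputable def fugV (k : ℤ) : FugL := ⟨_, fugV_mem k⟩

theorem fugV_apply (k : ℤ) (p : ℤ × ℕ) : fugV k p =
    if p.1 = k then ((fugC p.2 * fugR p.2 ^ (-k) : ℝ) : ℂ) else 0 := rfl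

noncomputable def fugG : Submodule ℂ FugL where
  carrier := {g | ∀ k, ⟪fugV k, g⟫_ℂ = 0}
  add_mem' := by
    intro a b ha hb k
    rw [inner_add_right, ha k, hb k, add_zero]
  zero_mem' := by intro k; simp
  smul_mem' := by
    intro c a ha k
    rw [inner_smul_right, ha k, mul_zero]

theorem mem_fugG (g : FugL) : g ∈ fugG ↔ ∀ k, ⟪fugV k, g⟫_ℂ = 0 := Iff.rfl

theorem fugG_closed : IsClosed (fugG : Set FugL) := by
  have : (fugG : Set FugL) = ⋂ k, {g | ⟪fugV k, g⟫_ℂ = 0} := by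
    ext g; simp [mem_fugG]
  rw [this]
  exact isClosed_iInter fun k => isClosed_eq (by fun_prop) continuous_const

noncomputable def fugB : FugL →L[ℂ] FugL := fugOp 0 fugC 1 fugC_le
noncomputable def fugM : FugL →L[ℂ] FugL := fugOp (-1) fugR 2 fugR_le
noncomputable def fugMs : FugL →L[ℂ] FugL := fugOp 1 fugR 2 fugR_le
noncomputable def fugMi : FugL →L[ℂ] FugL := fugOp 1 (fun j => (fugR j)⁻¹) 1 fugRi_le
noncomputable def fugN : FugL →L[ℂ] FugL := fugOp (-1) (fun j => (fugR j)⁻¹) 1 fugRi_le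

theorem fugRc (j : ℕ) : (fugR j : ℂ) ≠ 0 := by exact_mod_cast (fugR_pos j).ne'
theorem fugCc (j : ℕ) : (fugC j : ℂ) ≠ 0 := by exact_mod_cast (fugC_pos j).ne'

theorem fugB_inj : Function.Injective fugB := by
  intro f g h
  ext p
  have := congrArg (fun q : FugL => q p) h
  simp only [fugB, fugOp_apply, add_zero] at this
  exact mul_left_cancel₀ (fugCc _) this

/-- The test vectors in `G`. -/
noncomputable def fugTest (k : ℤ) (i j : ℕ) : FugL :=
  lp.single 2 (k, i) ((fugC j * fugR j ^ (-k) : ℝ) : ℂ) -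
    lp.single 2 (k, j) ((fugC i * fugR i ^ (-k) : ℝ) : ℂ)

theorem fugTest_inner (f : FugL) (k : ℤ) (i j : ℕ) : ⟪f, fugTest k i j⟫_ℂ =
    starRingEnd ℂ (f (k, i)) * ((fugC j * fugR j ^ (-k) : ℝ) : ℂ) -
    starRingEnd ℂ (f (k, j)) * ((fugC i * fugR i ^ (-k) : ℝ) : ℂ) := by
  unfold fugTest
  rw [inner_sub_right, lp.inner_single_right, lp.inner_single_right]
  simp only [RCLike.inner_apply]
  ring

theorem fugTest_mem (k : ℤ) (i j : ℕ) : fugTest k i j ∈ fugG := by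
  intro l
  rw [fugTest_inner]
  simp only [fugV_apply]
  split_ifs with h
  · subst h
    rw [Complex.conj_ofReal, Complex.conj_ofReal]
    ring
  · simp

theorem fug_dense : Dense (fugB '' (fugG : Set FugL)) := by
  have : fugB '' (fugG : Set FugL) = ((fugG.map (fugB : FugL →ₗ[ℂ] FugL) : Submodule ℂ FugL) : Set FugL) := by
    simp
  rw [this, Submodule.dense_iff_topologicalClosure_eq_top,
    Submodule.topologicalClosure_eq_top_iff, Submodule.eq_bot_iff]
  intro h hh
  rw [Submodule.mem_orthogonal'] at hh
  have key : ∀ k i j, starRingEnd ℂ (h (k, i)) * ((fugR j ^ (-k) : ℝ) : ℂ) =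
      starRingEnd ℂ (h (k, j)) * ((fugR i ^ (-k) : ℝ) : ℂ) := by
    intro k i j
    have h1 := hh (fugB (fugTest k i j)) ⟨_, fugTest_mem k i j, rfl⟩
    have h2 : ⟪h, fugB (fugTest k i j)⟫_ℂ = ⟪fugB h, fugTest k i j⟫_ℂ := by
      simp only [fugB]
      rw [fugOp_inner]
      simp
    rw [h2, fugTest_inner] at h1
    simp only [fugB, fugOp_apply, add_zero, map_mul, Complex.conj_ofReal] at h1
    have h3 := mul_ne_zero (fugCc i) (fugCc j)
    apply mul_left_cancel₀ h3
    push_cast at h1 ⊢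
    linear_combination h1
  have hconst : ∀ k j, h (k, j + 1) = h (k, 1) := by
    intro k j
    have := key k (j + 1) 1
    simp [fugR] at this
    exact (starRingEnd ℂ).injective this
  have h1 : ∀ k, h (k, 1) = 0 := by
    intro k
    have hs : Summable fun j : ℕ => ‖h (k, j + 1)‖ ^ 2 := by
      have := (fug_summable_sq h).comp_injective (i := fun j : ℕ => (k, j + 1))
        (fun a b h => by simpa using h)
      exact this
    simp only [hconst] at hs
    have := (summable_const_iff _).1 hs
    simpa using this
  ext ⟨k, j⟩
  rcases j with _ | j
  · have := key k 0 1
    rw [h1 k] at this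
    simpa [fugR] using this
  · rw [hconst, h1]
    rfl

theorem fug_MiV (k : ℤ) : fugN (fugV k) = fugV (k + 1) := by
  ext ⟨l, j⟩
  simp only [fugN, fugOp_apply, fugV_apply]
  by_cases h : l = k + 1
  · subst h
    have := fugRc j
    simp only [add_neg_cancel_right, if_true]
    push_cast
    rw [neg_add, zpow_add₀ this]
    simp
    ring
  · rw [if_neg h, if_neg (by omega), mul_zero]

theorem fug_exists (E : Type) [NormedAddCommGroup E] [InnerProductSpace ℂ E] [CompleteSpace E]
    (e : E ≃ₗᵢ[ℂ] FugL) :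
    ∃ T M : E →ₗ.[ℂ] E,
      T.IsClosed ∧ Dense (T.domain : Set E) ∧ M.IsNormalOp ∧
        T.pcomp M ≤ M.pcomp T ∧
        ¬(T.pcomp M.adjoint ≤ M.adjoint.pcomp T) ∧
        ¬(M.adjoint.pcomp T ≤ T.pcomp M.adjoint) := by
  let cj : (FugL →L[ℂ] FugL) → (E →L[ℂ] E) := fun A =>
    (e.symm.toContinuousLinearEquiv : FugL →L[ℂ] E) ∘L A ∘L (e.toContinuousLinearEquiv : E →L[ℂ] FugL)
  have cja : ∀ A x, cj A x = e.symm (A (e x)) := fun A x => rfl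
  have hMB : ∀ f, fugMs (fugB f) = fugB (fugMs f) := by
    intro f
    ext p
    simp only [fugMs, fugB, fugOp_apply, add_zero]
    ring
  refine fug_abstract (cj fugB) (cj fugM) (cj fugMs) (fugG.comap (e.toLinearEquiv : E →ₗ[ℂ] FugL))
    ?_ ?_ ?_ ?_ ?_ ?_ ?_ ?_
  · intro x y h
    rw [cja, cja] at h
    exact e.injective (fugB_inj (e.symm.injective h))
  · exact fugG_closed.preimage e.continuous
  · have : cj fugB '' ((fugG.comap (e.toLinearEquiv : E →ₗ[ℂ] FugL) : Submodule ℂ E) : Set E) =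
        e.symm '' (fugB '' (fugG : Set FugL)) := by
      ext x
      constructor
      · rintro ⟨y, hy, rfl⟩
        exact ⟨_, ⟨e y, hy, rfl⟩, rfl⟩
      · rintro ⟨_, ⟨y, hy, rfl⟩, rfl⟩
        refine ⟨e.symm y, ?_, ?_⟩
        · simpa using hy
        · rw [cja]; simp
    rw [this]
    exact e.symm.surjective.denseRange.dense_image e.symm.continuous fug_dense
  · intro x y
    have h := fugOp_inner 1 fugR 2 fugR_le (e x) (e y)
    rw [cja, cja, ← e.inner_map_map, ← e.inner_map_map x]
    simp only [LinearIsometryEquiv.apply_symm_apply]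
    exact h
  · intro x
    simp only [cja, LinearIsometryEquiv.apply_symm_apply]
    congr 1
    ext p
    simp only [fugMs, fugM, fugOp_apply]
    simp
  · intro x z hz h
    have hz' : e z ∈ fugG := hz
    simp only [cja] at h
    have h := e.symm.injective h
    refine ⟨e.symm (fugMi (e z)), ?_, ?_, ?_⟩
    · change e (e.symm (fugMi (e z))) ∈ fugG
      rw [LinearIsometryEquiv.apply_symm_apply]
      intro k
      have : ⟪fugV k, fugMi (e z)⟫_ℂ = ⟪fugN (fugV k), e z⟫_ℂ := by
        simp only [fugN, fugMi]
        rw [fugOp_inner]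
        simp
      rw [this, fug_MiV]
      exact hz' _
    · rw [cja, LinearIsometryEquiv.apply_symm_apply, LinearIsometryEquiv.symm_apply_eq]
      have hc : fugB (fugMi (e z)) = fugMi (fugB (e z)) := by
        ext p
        simp only [fugMi, fugB, fugOp_apply, add_zero]
        ring
      rw [hc, ← h]
      ext p
      have := fugRc p.2
      simp only [fugMi, fugM, fugOp_apply]
      simp [this]
    · rw [cja, LinearIsometryEquiv.apply_symm_apply, LinearIsometryEquiv.symm_apply_eq]
      ext p
      have := fugRc p.2
      simp only [fugMi, fugM, fugOp_apply]
      simp [this]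
  · refine ⟨e.symm (fugB (fugN (fugTest 0 0 1))), e.symm (fugTest 0 0 1), ?_, ?_, ?_⟩
    · change e (e.symm _) ∈ fugG
      rw [LinearIsometryEquiv.apply_symm_apply]
      exact fugTest_mem _ _ _
    · rw [cja, cja, LinearIsometryEquiv.apply_symm_apply, LinearIsometryEquiv.apply_symm_apply, hMB]
      congr 2
      ext p
      have := fugRc p.2
      simp only [fugMs, fugN, fugOp_apply]
      simp [this]
    · intro z' hz' h
      have hz' : e z' ∈ fugG := hz'
      rw [cja] at h
      have h := fugB_inj (e.symm.injective h)
      rw [h] at hz'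
      have h4 := hz' 1
      have h5 : ⟪fugV 1, fugN (fugTest 0 0 1)⟫_ℂ = ⟪fugMi (fugV 1), fugTest 0 0 1⟫_ℂ := by
        simp only [fugN, fugMi]
        rw [fugOp_inner]
      rw [h5, fugTest_inner] at h4
      simp only [fugMi, fugOp_apply, fugV_apply] at h4
      simp [fugR, fugC] at h4
      have h2c : (starRingEnd ℂ) (2 : ℂ) = 2 := Complex.conj_ofNat 2
      rw [h2c] at h4
      norm_num at h4
  · refine ⟨e.symm (fugTest 0 0 1), ?_, ?_⟩
    · change e (e.symm _) ∈ fugG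
      rw [LinearIsometryEquiv.apply_symm_apply]
      exact fugTest_mem _ _ _
    · intro z' hz' h
      have hz' : e z' ∈ fugG := hz'
      simp only [cja, LinearIsometryEquiv.apply_symm_apply] at h
      have h := e.symm.injective h
      rw [hMB] at h
      have h := fugB_inj h
      rw [← h] at hz'
      have h4 := hz' (-1)
      have h5 : ⟪fugV (-1), fugMs (fugTest 0 0 1)⟫_ℂ = ⟪fugM (fugV (-1)), fugTest 0 0 1⟫_ℂ := by
        simp only [fugM, fugMs]
        rw [fugOp_inner]
        simp
      rw [h5, fugTest_inner] at h4
      simp only [fugM, fugOp_apply, fugV_apply] at h4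
      simp [fugR, fugC] at h4
      have h2c : (starRingEnd ℂ) (2 : ℂ) = 2 := Complex.conj_ofNat 2
      rw [h2c] at h4
      norm_num at h4

end FugledeConcrete

/-- On the Hilbert space `L²(ℝ) ⊕ L²(ℝ)` there exist a closed densely defined operator `T`
and an unbounded normal operator `M` with `T M ⊆ M T` but `T M* ⊄ M* T` and `M* T ⊄ T M*`:
the Fuglede theorem fails for closed `T` without the assumption `dom M ⊆ dom T`. -/
theorem exists_closed_normal_fuglede_fails :
    ∃ T M : L2PlusL2 →ₗ.[ℂ] L2PlusL2,
      T.IsClosed ∧ Dense (T.domain : Set L2PlusL2) ∧ M.IsNormalOp ∧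
        T.pcomp M ≤ M.pcomp T ∧
        ¬(T.pcomp M.adjoint ≤ M.adjoint.pcomp T) ∧
        ¬(M.adjoint.pcomp T ≤ T.pcomp M.adjoint) := by
  obtain ⟨e⟩ := fug_equiv L2PlusL2 fug_infdim
  exact fug_exists L2PlusL2 e
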